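/- Let Γ be a finitely generated group and let μ be an admissible probability measure on Γ whose random walk is transient at the spectral radius. Then ω_Γ(1) ≤ 0. Moreover, if Γ has exponential growth (v > 0), then there exists a constant C > 0 such that H_1(n) ≤ C n³ for all n ≥ 1. -/

import Mathlib

open scoped Pointwise Classical
open Filter

namespace GreenGrowth

variable {G : Type*} [Group G]

/-- Word length with respect to a finite generating set `S` (symmetrized). -/
noncomputable def wordLength (S : Finset G) (x : G) : ℕ :=
  sInf {n : ℕ | x ∈ ((S : Set G) ∪ (S : Set G)⁻¹) ^ n}

/-- `n`-step distribution of the `μ`-random walk: the `n`-fold convolution power of `μ`,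
so that `p_n(x, y) = convPow μ n (x⁻¹ * y)`. -/
noncomputable def convPow (μ : G → ℝ) : ℕ → G → ℝ
  | 0 => fun x => if x = 1 then 1 else 0
  | n + 1 => fun x => ∑' y : G, μ y * convPow μ n (y⁻¹ * x)

/-- The Green function `G(e, x | r)`. -/
noncomputable def green (μ : G → ℝ) (r : ℝ) (x : G) : ℝ :=
  ∑' n : ℕ, r ^ n * convPow μ n x

/-- `μ` is a probability measure on `G`. -/
def IsProbMeasure (μ : G → ℝ) : Prop := (∀ x, 0 ≤ μ x) ∧ HasSum μ 1

/-- `μ` is admissible: its support generates `G` as a semigroup, i.e. every element of `G`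
is reached with positive probability at some time. -/
def IsAdmissible (μ : G → ℝ) : Prop := ∀ x : G, ∃ n : ℕ, 0 < convPow μ n x

/-- `μ` is symmetric. -/
def IsSymm (μ : G → ℝ) : Prop := ∀ x : G, μ x⁻¹ = μ x

/-- The spectral radius of the `μ`-random walk. -/
noncomputable def spectralRadius (μ : G → ℝ) : ℝ :=
  limsup (fun n : ℕ => (convPow μ n 1) ^ ((n : ℝ)⁻¹)) atTop

/-- `R`, the radius of convergence of the Green function: the inverse of the
spectral radius. -/
noncomputable def greenRadius (μ : G → ℝ) : ℝ := (spectralRadius μ)⁻¹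

/-- The `μ`-random walk is transient at the spectral radius: the Green function
`G(x, y | r)` is finite for all `x, y` and all `0 < r ≤ R`. -/
def TransientAtSpectralRadius (μ : G → ℝ) : Prop :=
  ∀ r : ℝ, 0 < r → r ≤ greenRadius μ →
    ∀ x : G, Summable (fun n : ℕ => r ^ n * convPow μ n x)

/-- `H_r(n) = Σ_{x ∈ S_n} G(e, x | r)`, the sum of the Green function over the sphere
of radius `n`. -/
noncomputable def greenSphereSum (S : Finset G) (μ : G → ℝ) (r : ℝ) (n : ℕ) : ℝ :=
  ∑' x : G, if wordLength S x = n then green μ r x else 0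

/-- `ω_Γ(r) = limsup (1/n) log H_r(n)`, the growth rate of the Green function. -/
noncomputable def greenGrowthRate (S : Finset G) (μ : G → ℝ) (r : ℝ) : ℝ :=
  limsup (fun n : ℕ => Real.log (greenSphereSum S μ r n) / n) atTop

/-- The cardinality of the sphere of radius `n`. -/
noncomputable def sphereCard (S : Finset G) (n : ℕ) : ℕ :=
  Nat.card {x : G // wordLength S x = n}

/-- The volume growth rate `v = limsup (1/n) log #S_n`. -/
noncomputable def volumeGrowthRate (S : Finset G) : ℝ :=
  limsup (fun n : ℕ => Real.log (sphereCard S n) / n) atTop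

end GreenGrowth

namespace GreenGrowth

open scoped ENNReal

section Convolution

variable {G : Type*} [Group G]

/-- Convolution of nonnegative extended-real functions on a group. -/
noncomputable def conv (f g : G → ℝ≥0∞) (x : G) : ℝ≥0∞ := ∑' y, f y * g (y⁻¹ * x)

/-- The Dirac mass at the identity. -/
noncomputable def dirac (x : G) : ℝ≥0∞ := if x = 1 then 1 else 0

/-- Iterated convolution powers. -/
noncomputable def convIter (f : G → ℝ≥0∞) : ℕ → G → ℝ≥0∞
  | 0 => dirac
  | n + 1 => conv f (convIter f n)

lemma dirac_conv (f : G → ℝ≥0∞) : conv dirac f = f := by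
  ext x
  rw [conv, tsum_eq_single 1 (by intro y hy; simp [dirac, hy])]
  simp [dirac]

lemma conv_assoc (f g h : G → ℝ≥0∞) : conv (conv f g) h = conv f (conv g h) := by
  ext x
  simp only [conv, ← ENNReal.tsum_mul_left, ← ENNReal.tsum_mul_right]
  rw [ENNReal.tsum_comm]
  refine tsum_congr fun y => ?_
  rw [← (Equiv.mulLeft y).tsum_eq]
  refine tsum_congr fun z => ?_
  simp [mul_assoc]

lemma tsum_conv (f g : G → ℝ≥0∞) : ∑' x, conv f g x = (∑' x, f x) * ∑' x, g x := by
  simp only [conv]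
  rw [ENNReal.tsum_comm, ← ENNReal.tsum_mul_right]
  refine tsum_congr fun y => ?_
  rw [ENNReal.tsum_mul_left]
  congr 1
  exact (Equiv.mulLeft y⁻¹).tsum_eq g

lemma tsum_dirac : ∑' x : G, dirac x = 1 := by
  rw [tsum_eq_single 1 (by intro y hy; simp [dirac, hy])]
  simp [dirac]

lemma tsum_convIter {f : G → ℝ≥0∞} (hf : ∑' x, f x = 1) (n : ℕ) :
    ∑' x, convIter f n x = 1 := by
  induction n with
  | zero => exact tsum_dirac
  | succ n ih => rw [convIter, tsum_conv, hf, ih, one_mul]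

lemma convIter_le_one {f : G → ℝ≥0∞} (hf : ∑' x, f x = 1) (n : ℕ) (x : G) :
    convIter f n x ≤ 1 :=
  (ENNReal.le_tsum x).trans (tsum_convIter hf n).le

lemma conv_tsum {ι : Type*} (f : G → ℝ≥0∞) (g : ι → G → ℝ≥0∞) (x : G) :
    conv f (fun z => ∑' i, g i z) x = ∑' i, conv f (g i) x := by
  simp only [conv, ← ENNReal.tsum_mul_left]
  exact ENNReal.tsum_comm

lemma conv_mono_right (f : G → ℝ≥0∞) {g h : G → ℝ≥0∞} (hgh : ∀ x, g x ≤ h x) (x : G) :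
    conv f g x ≤ conv f h x :=
  ENNReal.tsum_le_tsum fun _ => by gcongr; exact hgh _

/-- Recursion for the truncated Green function. -/
lemma sum_convIter_succ (f : G → ℝ≥0∞) (n : ℕ) (x : G) :
    ∑ k ∈ Finset.range (n + 1), convIter f k x =
      dirac x + conv f (fun z => ∑ k ∈ Finset.range n, convIter f k z) x := by
  rw [Finset.sum_range_succ', add_comm]
  congr 1
  simp only [conv, Finset.mul_sum, convIter]
  rw [Summable.tsum_finsetSum fun _ _ => ENNReal.summable]

/-- The Green function in extended nonnegative reals. -/
noncomputable def greenE (f : G → ℝ≥0∞) (x : G) : ℝ≥0∞ := ∑' n, convIter f n x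

lemma greenE_eq_dirac_add (f : G → ℝ≥0∞) (x : G) :
    greenE f x = dirac x + conv f (greenE f) x := by
  rw [greenE, tsum_eq_zero_add' ENNReal.summable]
  congr 1
  exact (conv_tsum f (convIter f) x).symm

/-- The Green function is the smallest supersolution of `g = δ + f * g`. -/
lemma greenE_le_of_supersolution {f g : G → ℝ≥0∞} (h : ∀ x, dirac x + conv f g x ≤ g x)
    (x : G) : greenE f x ≤ g x := by
  have key : ∀ n x, ∑ k ∈ Finset.range n, convIter f k x ≤ g x := by
    intro n
    induction n with
    | zero => simp
    | succ n ih =>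
      intro x
      rw [sum_convIter_succ]
      exact (add_le_add le_rfl (conv_mono_right f ih x)).trans (h x)
  rw [greenE, ENNReal.tsum_eq_iSup_nat]
  exact iSup_le fun n => key n x

/-- Maximum principle: the Green function is maximal on the diagonal. -/
lemma greenE_le_greenE_one {f : G → ℝ≥0∞} (hf : ∑' x, f x = 1) (x : G) :
    greenE f x ≤ greenE f 1 := by
  have key : ∀ n x, ∑ k ∈ Finset.range n, convIter f k x ≤ greenE f 1 := by
    intro n
    induction n with
    | zero => simp
    | succ n ih =>
      intro x
      by_cases hx : x = 1
      · subst hx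
        exact ENNReal.sum_le_tsum _
      · rw [sum_convIter_succ, dirac, if_neg hx, zero_add]
        calc conv f (fun z => ∑ k ∈ Finset.range n, convIter f k z) x
            ≤ ∑' y, f y * greenE f 1 := ENNReal.tsum_le_tsum fun y => by gcongr; exact ih _
          _ = greenE f 1 := by rw [ENNReal.tsum_mul_right, hf, one_mul]
  rw [greenE, ENNReal.tsum_eq_iSup_nat]
  exact iSup_le fun n => key n x

lemma convIter_mul_le (f : G → ℝ≥0∞) (m n : ℕ) (x y : G) :
    convIter f m x * convIter f n y ≤ convIter f (m + n) (x * y) := by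
  have key : convIter f (m + n) = conv (convIter f m) (convIter f n) := by
    induction m with
    | zero => rw [convIter, dirac_conv, zero_add]
    | succ m ih => rw [Nat.succ_add, convIter, ih, convIter, conv_assoc]
  rw [key, conv]
  exact le_trans (by simp) (ENNReal.le_tsum x)

/-- If the Green function is infinite at the identity then it is infinite everywhere the
walk can go. -/
lemma greenE_eq_top {f : G → ℝ≥0∞} (h : greenE f 1 = ∞) {x : G} {m : ℕ}
    (hx : convIter f m x ≠ 0) : greenE f x = ∞ := by
  rw [← top_le_iff]
  calc ∞ = ∑' n, convIter f m x * convIter f n 1 := by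
        rw [ENNReal.tsum_mul_left, ← greenE, h, ENNReal.mul_top hx]
    _ ≤ ∑' n, convIter f (m + n) x := ENNReal.tsum_le_tsum fun n => by
        simpa using convIter_mul_le f m n x 1
    _ ≤ greenE f x := ENNReal.tsum_comp_le_tsum_of_injective (add_right_injective m) _

/-- The geometric average `∑ 2⁻ᵏ⁻¹ f^{*k}` of the convolution powers of `f`. -/
noncomputable def resolvent (f : G → ℝ≥0∞) (x : G) : ℝ≥0∞ :=
  ∑' k, 2⁻¹ ^ (k + 1) * convIter f k x

lemma tsum_two_inv_pow_succ : ∑' k : ℕ, (2⁻¹ : ℝ≥0∞) ^ (k + 1) = 1 := by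
  rw [ENNReal.tsum_geometric_add_one, ENNReal.one_sub_inv_two, inv_inv]
  exact ENNReal.inv_mul_cancel (by simp) (by simp)

lemma tsum_resolvent {f : G → ℝ≥0∞} (hf : ∑' x, f x = 1) : ∑' x, resolvent f x = 1 := by
  simp only [resolvent]
  rw [ENNReal.tsum_comm]
  simp only [ENNReal.tsum_mul_left, tsum_convIter hf, mul_one]
  exact tsum_two_inv_pow_succ

lemma resolvent_ne_zero {f : G → ℝ≥0∞} {x : G} {k : ℕ} (h : convIter f k x ≠ 0) :
    resolvent f x ≠ 0 := by
  intro h0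
  rw [resolvent, ENNReal.tsum_eq_zero] at h0
  simpa [h] using h0 k

lemma resolvent_eq (f : G → ℝ≥0∞) (x : G) :
    resolvent f x = 2⁻¹ * dirac x + 2⁻¹ * conv f (resolvent f) x := by
  unfold resolvent
  rw [tsum_eq_zero_add' ENNReal.summable, conv_tsum]
  simp only [zero_add, pow_one, convIter]
  congr 1
  rw [← ENNReal.tsum_mul_left]
  refine tsum_congr fun k => ?_
  simp only [conv, ← ENNReal.tsum_mul_left]
  refine tsum_congr fun y => ?_
  ring

/-- Passing to the geometric average of the powers does not decrease the Green function. -/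
lemma greenE_le_greenE_resolvent {f : G → ℝ≥0∞} (hfin : ∀ x, greenE (resolvent f) x ≠ ∞)
    (x : G) : greenE f x ≤ greenE (resolvent f) x := by
  set g := greenE (resolvent f)
  set K := conv (resolvent f) g
  have hgK : ∀ x, g x = dirac x + K x := greenE_eq_dirac_add (resolvent f)
  have hKg : ∀ x, K x ≤ g x := fun x => (hgK x).symm ▸ le_add_self
  have hK : ∀ x, K x = 2⁻¹ * (dirac x + conv f K x) + 2⁻¹ * K x := by
    intro x
    have h1 : K x = 2⁻¹ * g x + 2⁻¹ * conv f K x := by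
      have h2 : conv f K = conv (conv f (resolvent f)) g := (conv_assoc ..).symm
      have h3 : conv dirac g = g := dirac_conv g
      rw [h2, ← congrFun h3 x]
      simp only [K, conv, ← ENNReal.tsum_mul_left]
      rw [← ENNReal.tsum_add]
      refine tsum_congr fun y => ?_
      rw [resolvent_eq f y]
      simp only [conv, ← ENNReal.tsum_mul_left]
      rw [add_mul, ENNReal.tsum_mul_left]
      ring
    conv_lhs => rw [h1, hgK x]
    ring
  refine le_trans (greenE_le_of_supersolution (g := K) (fun x => ?_) x) (hKg x)
  have hKfin : K x ≠ ∞ := ne_top_of_le_ne_top (hfin x) (hKg x)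
  have h1 : 2⁻¹ * K x + 2⁻¹ * K x = 2⁻¹ * (dirac x + conv f K x) + 2⁻¹ * K x := by
    rw [← hK x, ← add_mul, ENNReal.inv_two_add_inv_two, one_mul]
  have h2 := (ENNReal.add_left_inj (ENNReal.mul_ne_top (by simp) hKfin)).mp h1
  exact ((ENNReal.mul_right_inj (by simp) (by simp)).mp h2).ge

end Convolution

section Hilbert

variable {E : Type*} [NormedAddCommGroup E] [InnerProductSpace ℝ E] {ι : Type*}

/-- A convex combination of vectors of norm `a` loses norm as soon as it charges two distinct
vectors. -/
lemma norm_sq_le_of_hasSum_convex {p : ι → ℝ} (hp : ∀ i, 0 ≤ p i) (hp1 : HasSum p 1)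
    {v : ι → E} {w : E} {a c : ℝ} (hv : ∀ i, ‖v i‖ = a) (hw : HasSum (fun i => p i • v i) w)
    {i j : ι} (hi : c ≤ p i) (hj : c ≤ p j) :
    ‖w‖ ^ 2 ≤ a ^ 2 - c / 4 * ‖v i - v j‖ ^ 2 := by
  have hinner : HasSum (fun k => p k * inner ℝ w (v k)) (‖w‖ ^ 2) := by
    have := hw.mapL (innerSL ℝ w)
    simpa [real_inner_self_eq_norm_sq, inner_smul_right] using this
  have hvar : HasSum (fun k => p k * ‖v k - w‖ ^ 2) (a ^ 2 - ‖w‖ ^ 2) := by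
    have h := ((hp1.mul_right (a ^ 2 + ‖w‖ ^ 2)).sub (hinner.mul_left 2))
    rw [show a ^ 2 - ‖w‖ ^ 2 = 1 * (a ^ 2 + ‖w‖ ^ 2) - 2 * ‖w‖ ^ 2 by ring]
    refine Eq.mp (congrArg (HasSum · _) (funext fun k => ?_)) h
    rw [norm_sub_sq_real, hv, real_inner_comm]
    ring
  have hnn : ∀ k, 0 ≤ p k * ‖v k - w‖ ^ 2 := fun k => mul_nonneg (hp k) (sq_nonneg _)
  have key : ∀ k, c ≤ p k → c * ‖v k - w‖ ^ 2 ≤ a ^ 2 - ‖w‖ ^ 2 := fun k hk =>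
    (mul_le_mul_of_nonneg_right hk (sq_nonneg _)).trans (le_hasSum hvar k fun l _ => hnn l)
  have h0 : 0 ≤ a ^ 2 - ‖w‖ ^ 2 := hvar.nonneg hnn
  rcases le_total c 0 with hc | hc
  · nlinarith [sq_nonneg ‖v i - v j‖]
  have htri : ‖v i - v j‖ ≤ ‖v i - w‖ + ‖v j - w‖ := by
    rw [norm_sub_rev (v j) w]
    exact norm_sub_le_norm_sub_add_norm_sub ..
  have hsq : ‖v i - v j‖ ^ 2 ≤ 2 * (‖v i - w‖ ^ 2 + ‖v j - w‖ ^ 2) := by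
    nlinarith [norm_nonneg (v i - v j), sq_nonneg (‖v i - w‖ - ‖v j - w‖)]
  nlinarith [key i hi, key j hj, mul_le_mul_of_nonneg_left hsq hc]

end Hilbert

section Shift

lemma memℓp_two_iff {α : Type*} {f : α → ℝ} : Memℓp f 2 ↔ Summable fun x => f x ^ 2 := by
  rw [memℓp_gen_iff (by simp)]
  simp

lemma hasSum_norm_sq {α : Type*} (f : lp (fun _ : α => ℝ) 2) :
    HasSum (fun x => f x ^ 2) (‖f‖ ^ 2) := by
  simpa using lp.hasSum_norm (p := 2) (by simp) f

variable {G : Type*} [Group G]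

/-- Left translation on `ℓ²(G)`. -/
noncomputable def leftShift (g : G) : lp (fun _ : G => ℝ) 2 →ₗᵢ[ℝ] lp (fun _ : G => ℝ) 2 where
  toFun f := ⟨fun x => f (g⁻¹ * x), memℓp_two_iff.mpr <|
    (Equiv.mulLeft g⁻¹).summable_iff.mpr (hasSum_norm_sq f).summable⟩
  map_add' _ _ := rfl
  map_smul' _ _ := rfl
  norm_map' f := by
    have h := hasSum_norm_sq f
    rw [← (Equiv.mulLeft g⁻¹).hasSum_iff] at h
    exact (sq_eq_sq₀ (norm_nonneg _) (norm_nonneg _)).mp ((hasSum_norm_sq _).unique h)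

@[simp]
lemma leftShift_apply (g : G) (f : lp (fun _ : G => ℝ) 2) (x : G) :
    leftShift g f x = f (g⁻¹ * x) := rfl

lemma leftShift_mul (g h : G) (f : lp (fun _ : G => ℝ) 2) :
    leftShift (g * h) f = leftShift g (leftShift h f) := by
  ext x
  simp [mul_assoc]

/-- A function that is almost invariant under a set is almost invariant under its powers. -/
lemma norm_leftShift_sub_le {A : Set G} {f : lp (fun _ : G => ℝ) 2} {η : ℝ}
    (h : ∀ s ∈ A, ‖leftShift s f - f‖ ≤ η) (n : ℕ) {y : G} (hy : y ∈ A ^ n) :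
    ‖leftShift y f - f‖ ≤ n * η := by
  induction n generalizing y with
  | zero =>
    have hy1 : y = 1 := by simpa using hy
    have : leftShift (1 : G) f = f := by ext x; simp
    simp [hy1, this]
  | succ n ih =>
    rw [pow_succ] at hy
    obtain ⟨u, hu, s, hs, rfl⟩ := Set.mem_mul.mp hy
    calc ‖leftShift (u * s) f - f‖
        = ‖leftShift u (leftShift s f - f) + (leftShift u f - f)‖ := by
          rw [leftShift_mul, map_sub]; congr 1; abel
      _ ≤ ‖leftShift u (leftShift s f - f)‖ + ‖leftShift u f - f‖ := norm_add_le _ _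
      _ ≤ η + n * η := by
          rw [LinearIsometry.norm_map]
          exact add_le_add (h s hs) (ih hu)
      _ = (n + 1 : ℕ) * η := by push_cast; ring

/-- The sum of the translates of a probability density over a finite set. -/
lemma norm_sq_sum_leftShift_le (B : Finset G) {f : lp (fun _ : G => ℝ) 2}
    (hf : ∀ x, 0 ≤ f x) (hf1 : HasSum f 1) : ‖∑ y ∈ B, leftShift y f‖ ^ 2 ≤ B.card := by
  have happ : ∀ x, (∑ y ∈ B, leftShift y f) x = ∑ y ∈ B, f (y⁻¹ * x) := by
    intro x
    rw [lp.coeFn_sum, Finset.sum_apply]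
    rfl
  have hsum : HasSum (fun x => (∑ y ∈ B, leftShift y f) x) (B.card : ℝ) := by
    simp only [happ]
    have := hasSum_sum (s := B) fun y _ => (Equiv.mulLeft y⁻¹).hasSum_iff.mpr hf1
    simpa using this
  refine hasSum_le (fun x => ?_) (hasSum_norm_sq _) hsum
  have h0 : 0 ≤ (∑ y ∈ B, leftShift y f) x := by
    rw [happ]
    exact Finset.sum_nonneg fun y _ => hf _
  have h1 : (∑ y ∈ B, leftShift y f) x ≤ 1 := by
    rw [happ]
    have hinj : Function.Injective fun y : G => y⁻¹ * x := fun a b h => by simpa using h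
    exact (Finset.sum_map B ⟨_, hinj⟩ f).symm.trans_le (sum_le_hasSum _ (fun y _ => hf y) hf1)
  nlinarith

/-- Pseudo-Poincaré inequality for probability densities. -/
lemma norm_le_of_almost_invariant (A : Finset G) (n : ℕ) (hA : (A ^ n).Nonempty)
    {f : lp (fun _ : G => ℝ) 2} (hf : ∀ x, 0 ≤ f x) (hf1 : HasSum f 1) {η : ℝ}
    (h : ∀ s ∈ A, ‖leftShift s f - f‖ ≤ η) :
    ‖f‖ ≤ √((A ^ n).card : ℝ)⁻¹ + n * η := by
  set B := A ^ n with hB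
  have hpos : (0 : ℝ) < B.card := by exact_mod_cast hA.card_pos
  have hdiff : ‖∑ y ∈ B, (f - leftShift y f)‖ ≤ B.card * (n * η) := by
    rw [← nsmul_eq_mul, ← Finset.sum_const]
    refine norm_sum_le_of_le B fun y hy => ?_
    rw [norm_sub_rev]
    refine norm_leftShift_sub_le (A := (A : Set G)) (by simpa using h) n ?_
    rw [← Finset.coe_pow]
    exact_mod_cast hy
  have havg : ‖∑ y ∈ B, leftShift y f‖ ≤ √(B.card : ℝ) :=
    Real.le_sqrt_of_sq_le (norm_sq_sum_leftShift_le B hf hf1)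
  have htot : B.card * ‖f‖ ≤ √(B.card : ℝ) + B.card * (n * η) := by
    calc B.card * ‖f‖ = ‖∑ y ∈ B, leftShift y f + ∑ y ∈ B, (f - leftShift y f)‖ := by
          rw [← Finset.sum_add_distrib]
          simp [norm_smul, ← Nat.cast_smul_eq_nsmul ℝ]
      _ ≤ _ := (norm_add_le _ _).trans (add_le_add havg hdiff)
  have hs : (B.card : ℝ) * √(B.card : ℝ)⁻¹ = √(B.card : ℝ) := by
    rw [Real.sqrt_inv, ← div_eq_mul_inv, Real.div_sqrt]
  nlinarith [mul_add (B.card : ℝ) (√(B.card : ℝ)⁻¹) (n * η)]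

end Shift

section Decay

lemma ne_top_of_tsum_eq_one {α : Type*} {f : α → ℝ≥0∞} (hf : ∑' x, f x = 1) (x : α) : f x ≠ ∞ :=
  ENNReal.ne_top_of_tsum_ne_top (hf.trans_ne ENNReal.one_ne_top) x

lemma hasSum_toReal {α : Type*} {f : α → ℝ≥0∞} (hf : ∑' x, f x = 1) :
    HasSum (fun x => (f x).toReal) 1 := by
  have := ENNReal.hasSum_toReal (hf.trans_ne ENNReal.one_ne_top)
  rwa [← ENNReal.tsum_toReal_eq (ne_top_of_tsum_eq_one hf), hf, ENNReal.toReal_one] at this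

variable {G : Type*} [Group G]

/-- The convolution powers of a probability density as elements of `ℓ²(G)`. -/
noncomputable def convIterL2 {f : G → ℝ≥0∞} (hf : ∑' x, f x = 1) (n : ℕ) :
    lp (fun _ : G => ℝ) 2 :=
  ⟨fun x => (convIter f n x).toReal, memℓp_two_iff.mpr <| by
    refine (hasSum_toReal (tsum_convIter hf n)).summable.of_nonneg_of_le (fun x => sq_nonneg _)
      fun x => ?_
    have h0 : 0 ≤ (convIter f n x).toReal := ENNReal.toReal_nonneg
    have h1 : (convIter f n x).toReal ≤ 1 :=
      ENNReal.toReal_le_of_le_ofReal zero_le_one (by simpa using convIter_le_one hf n x)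
    nlinarith⟩

lemma convIterL2_apply {f : G → ℝ≥0∞} (hf : ∑' x, f x = 1) (n : ℕ) (x : G) :
    convIterL2 hf n x = (convIter f n x).toReal := rfl

lemma hasSum_convIterL2_succ {f : G → ℝ≥0∞} (hf : ∑' x, f x = 1) (n : ℕ) :
    HasSum (fun y => (f y).toReal • leftShift y (convIterL2 hf n)) (convIterL2 hf (n + 1)) := by
  have hsum : Summable fun y => (f y).toReal • leftShift y (convIterL2 hf n) := by
    refine Summable.of_norm ?_
    simp only [norm_smul, LinearIsometry.norm_map, Real.norm_eq_abs,
      abs_of_nonneg ENNReal.toReal_nonneg]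
    exact (hasSum_toReal hf).summable.mul_right _
  convert hsum.hasSum using 1
  ext x
  have h := hsum.hasSum.mapL (lp.evalCLM ℝ (fun _ : G => ℝ) 2 x)
  refine HasSum.unique ?_ h
  have hfin : ∑' y, f y * convIter f n (y⁻¹ * x) ≠ ∞ :=
    ne_top_of_tsum_eq_one (tsum_convIter hf (n + 1)) x
  have h2 := ENNReal.hasSum_toReal hfin
  rw [← ENNReal.tsum_toReal_eq (ENNReal.ne_top_of_tsum_ne_top hfin)] at h2
  simp only [ENNReal.toReal_mul] at h2
  exact h2

/-- Either the density is already spread over the ball, or its norm contracts. -/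
lemma norm_sq_convIterL2_le {f : G → ℝ≥0∞} (hf : ∑' x, f x = 1) {A : Finset G} (h1 : 1 ∈ A)
    {c : ℝ} (hc : 0 < c) (hfA : ∀ s ∈ A, c ≤ (f s).toReal) {m : ℕ} (hm : 1 ≤ m) (k : ℕ) :
    ‖convIterL2 hf k‖ ^ 2 ≤
      max (4 * ((A ^ m).card : ℝ)⁻¹) (Real.exp (-(c / (16 * m ^ 2)) * k)) := by
  have hm0 : (0 : ℝ) < m := by exact_mod_cast hm
  have hnonneg : ∀ k x, 0 ≤ convIterL2 hf k x := fun k x => ENNReal.toReal_nonneg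
  have hcontr : ∀ k, ∀ s ∈ A, ‖convIterL2 hf (k + 1)‖ ^ 2 ≤
      ‖convIterL2 hf k‖ ^ 2 - c / 4 * ‖leftShift s (convIterL2 hf k) - convIterL2 hf k‖ ^ 2 := by
    intro k s hs
    have h := norm_sq_le_of_hasSum_convex (fun y => ENNReal.toReal_nonneg) (hasSum_toReal hf)
      (fun y => (leftShift y).norm_map _) (hasSum_convIterL2_succ hf k) (hfA s hs) (hfA 1 h1)
    have h2 : leftShift (1 : G) (convIterL2 hf k) = convIterL2 hf k := by ext x; simp
    rwa [h2] at h
  induction k with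
  | zero =>
    refine le_max_of_le_right ?_
    have h0 : HasSum (fun x => convIterL2 hf 0 x) 1 := hasSum_toReal (tsum_convIter hf 0)
    simp only [Nat.cast_zero, mul_zero, Real.exp_zero]
    refine hasSum_le (fun x => ?_) (hasSum_norm_sq _) h0
    by_cases hx : x = 1 <;> simp [convIterL2_apply, convIter, dirac, hx]
  | succ k ih =>
    set F := convIterL2 hf k with hF
    by_cases hsmall : ‖F‖ ^ 2 ≤ 4 * ((A ^ m).card : ℝ)⁻¹
    · refine le_max_of_le_left (le_trans ?_ hsmall)
      have := hcontr k 1 h1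
      nlinarith [sq_nonneg ‖leftShift 1 F - F‖]
    · push Not at hsmall
      have ihk : ‖F‖ ^ 2 ≤ Real.exp (-(c / (16 * m ^ 2)) * k) :=
        (le_max_iff.mp ih).resolve_left hsmall.not_ge
      refine le_max_of_le_right ?_
      have hex : ∃ s ∈ A, ‖F‖ / (2 * m) ≤ ‖leftShift s F - F‖ := by
        by_contra! hcon
        have hP := norm_le_of_almost_invariant A m (Finset.Nonempty.pow ⟨1, h1⟩) (hnonneg k)
          (hasSum_toReal (tsum_convIter hf k)) fun s hs => (hcon s hs).le
        have hlt : √((A ^ m).card : ℝ)⁻¹ < ‖F‖ / 2 := by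
          have hinv : (0 : ℝ) ≤ ((A ^ m).card : ℝ)⁻¹ := by positivity
          have hF0 : 0 < ‖F‖ := by
            by_contra hneg
            nlinarith [le_antisymm (not_lt.mp hneg) (norm_nonneg F)]
          rw [Real.sqrt_lt' (by positivity)]
          linarith [div_pow ‖F‖ 2 2]
        have he : (m : ℝ) * (‖F‖ / (2 * m)) = ‖F‖ / 2 := by field_simp
        rw [← hF, he] at hP
        linarith
      obtain ⟨s, hs, hle⟩ := hex
      have hsq : ‖F‖ ^ 2 / (4 * m ^ 2) ≤ ‖leftShift s F - F‖ ^ 2 := by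
        calc ‖F‖ ^ 2 / (4 * m ^ 2) = (‖F‖ / (2 * m)) ^ 2 := by ring
          _ ≤ _ := by gcongr
      calc ‖convIterL2 hf (k + 1)‖ ^ 2
          ≤ ‖F‖ ^ 2 - c / 4 * (‖F‖ ^ 2 / (4 * m ^ 2)) := by
            refine (hcontr k s hs).trans ?_
            gcongr
        _ = (-(c / (16 * m ^ 2)) + 1) * ‖F‖ ^ 2 := by ring
        _ ≤ Real.exp (-(c / (16 * m ^ 2))) * Real.exp (-(c / (16 * m ^ 2)) * k) := by
            gcongr
            exact Real.add_one_le_exp _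
        _ = Real.exp (-(c / (16 * m ^ 2)) * (k + 1 : ℕ)) := by
            rw [← Real.exp_add]; push_cast; ring_nf

/-- The Varopoulos bound: on a group of exponential growth, the convolution powers of a density
that is bounded below on a generating set decay like `exp (-b n^{1/3})`. -/
lemma exists_convIter_le_exp {f : G → ℝ≥0∞} (hf : ∑' x, f x = 1) {A : Finset G} (h1 : 1 ∈ A)
    (hfA : ∀ s ∈ A, f s ≠ 0) {v : ℝ} (hv : 0 < v)
    (hgrowth : ∀ m : ℕ, Real.exp (v * m) ≤ (A ^ m).card) :
    ∃ b C : ℝ, 0 < b ∧ 0 < C ∧ ∀ (k : ℕ) (x : G),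
      convIter f k x ≤ ENNReal.ofReal (C * Real.exp (-b * (k : ℝ) ^ (1 / 3 : ℝ))) := by
  obtain ⟨c, hc, hcA⟩ : ∃ c : ℝ, 0 < c ∧ ∀ s ∈ A, c ≤ (f s).toReal := by
    obtain ⟨s, hs, hmin⟩ := A.exists_min_image (fun s => (f s).toReal) ⟨1, h1⟩
    exact ⟨_, ENNReal.toReal_pos (hfA s hs) (ne_top_of_tsum_eq_one hf s), hmin⟩
  set a := min v (c / 16) with ha
  have ha0 : 0 < a := lt_min hv (by positivity)
  refine ⟨a / 2, 2 * Real.exp (a / 2), by positivity, by positivity, fun k x => ?_⟩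
  set t := (k : ℝ) ^ (1 / 3 : ℝ) with ht
  have ht0 : 0 ≤ t := by positivity
  have ht3 : t ^ 3 = k := by
    rw [ht, ← Real.rpow_natCast, ← Real.rpow_mul (by positivity)]
    norm_num
  rcases lt_or_ge t 1 with hlt | hge
  · refine (convIter_le_one hf k x).trans ?_
    rw [← ENNReal.ofReal_one]
    refine ENNReal.ofReal_le_ofReal ?_
    rw [mul_assoc, ← Real.exp_add]
    have : 1 ≤ Real.exp (a / 2 + -(a / 2) * t) := Real.one_le_exp (by nlinarith)
    linarith
  set m := ⌊t⌋₊ with hm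
  have hm1 : 1 ≤ m := Nat.one_le_floor_iff t |>.mpr hge
  have hmt : (m : ℝ) ≤ t := Nat.floor_le ht0
  have htm : t < m + 1 := Nat.lt_floor_add_one t
  have hm0 : (0 : ℝ) < m := by exact_mod_cast hm1
  have hmk : (m : ℝ) ^ 3 ≤ k := ht3 ▸ by gcongr
  have hF : ‖convIterL2 hf k‖ ^ 2 ≤ (2 * Real.exp (-(a / 2) * m)) ^ 2 := by
    have hexp : (2 * Real.exp (-(a / 2) * m)) ^ 2 = 4 * Real.exp (-a * m) := by
      rw [mul_pow, ← Real.exp_nat_mul]; norm_num; ring_nf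
    rw [hexp]
    refine (norm_sq_convIterL2_le hf h1 hc hcA hm1 k).trans (max_le ?_ ?_)
    · refine mul_le_mul_of_nonneg_left ?_ (by norm_num)
      rw [neg_mul, Real.exp_neg]
      refine inv_anti₀ (Real.exp_pos _) ?_
      refine le_trans ?_ (hgrowth m)
      gcongr
      exact min_le_left _ _
    · have h2 : Real.exp (-(c / (16 * m ^ 2)) * k) ≤ Real.exp (-a * m) := by
        rw [Real.exp_le_exp, neg_mul, neg_mul, neg_le_neg_iff]
        calc a * m ≤ c / 16 * m := by gcongr; exact min_le_right _ _
          _ = c / (16 * m ^ 2) * m ^ 3 := by field_simp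
          _ ≤ c / (16 * m ^ 2) * k := by gcongr
      linarith [Real.exp_pos (-a * m)]
  have hF' := (sq_le_sq₀ (norm_nonneg _) (by positivity)).mp hF
  have hx : (convIter f k x).toReal ≤ ‖convIterL2 hf k‖ := by
    have := lp.norm_apply_le_norm (p := 2) (by simp) (convIterL2 hf k) x
    rwa [convIterL2_apply, Real.norm_of_nonneg ENNReal.toReal_nonneg] at this
  rw [← ENNReal.ofReal_toReal (ne_top_of_tsum_eq_one (tsum_convIter hf k) x)]
  refine ENNReal.ofReal_le_ofReal (hx.trans (hF'.trans ?_))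
  rw [mul_assoc, ← Real.exp_add]
  gcongr
  nlinarith

end Decay

section Spheres

variable {G : Type*} [Group G]

/-- The symmetrized generating set together with the identity. -/
noncomputable def symmGen (S : Finset G) : Finset G := insert 1 (S ∪ S⁻¹)

lemma one_mem_symmGen (S : Finset G) : 1 ∈ symmGen S := Finset.mem_insert_self _ _

lemma one_le_card_symmGen_pow (S : Finset G) (n : ℕ) : 1 ≤ (symmGen S ^ n).card :=
  (Finset.Nonempty.pow ⟨1, one_mem_symmGen S⟩).card_pos

lemma mem_pow_wordLength {S : Finset G} (hS : Subgroup.closure (S : Set G) = ⊤) (x : G) :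
    x ∈ ((S : Set G) ∪ (S : Set G)⁻¹) ^ wordLength S x := by
  refine Nat.sInf_mem (s := {n : ℕ | x ∈ ((S : Set G) ∪ (S : Set G)⁻¹) ^ n}) ?_
  have hx : x ∈ Submonoid.closure ((S : Set G) ∪ (S : Set G)⁻¹) := by
    rw [← Subgroup.closure_toSubmonoid, hS]
    trivial
  induction hx using Submonoid.closure_induction with
  | mem x hx => exact ⟨1, by simpa using hx⟩
  | one => exact ⟨0, by simp⟩
  | mul x y _ _ hx hy =>
    obtain ⟨m, hm⟩ := hx
    obtain ⟨n, hn⟩ := hy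
    exact ⟨m + n, by rw [Set.mem_ofPred_eq, pow_add]; exact Set.mul_mem_mul hm hn⟩

/-- The sphere of radius `n` as a finite set. -/
noncomputable def sphere (S : Finset G) (n : ℕ) : Finset G :=
  (symmGen S ^ n).filter fun x => wordLength S x = n

lemma mem_sphere {S : Finset G} (hS : Subgroup.closure (S : Set G) = ⊤) {n : ℕ} {x : G} :
    x ∈ sphere S n ↔ wordLength S x = n := by
  refine ⟨fun h => (Finset.mem_filter.mp h).2, fun h => Finset.mem_filter.mpr ⟨?_, h⟩⟩
  have hx := mem_pow_wordLength hS x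
  rw [h] at hx
  have hsub : (S : Set G) ∪ (S : Set G)⁻¹ ⊆ (symmGen S : Set G) := by
    intro y hy
    simpa [symmGen] using Or.inr hy
  rw [← Finset.mem_coe, Finset.coe_pow]
  exact Set.pow_subset_pow_left hsub hx

lemma sphereCard_eq {S : Finset G} (hS : Subgroup.closure (S : Set G) = ⊤) (n : ℕ) :
    sphereCard S n = (sphere S n).card :=
  Nat.subtype_card _ fun _ => mem_sphere hS

lemma sphereCard_le {S : Finset G} (hS : Subgroup.closure (S : Set G) = ⊤) (n : ℕ) :
    sphereCard S n ≤ (symmGen S ^ n).card :=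
  (sphereCard_eq hS n).trans_le (Finset.card_filter_le _ _)

lemma greenSphereSum_eq {S : Finset G} (hS : Subgroup.closure (S : Set G) = ⊤) (μ : G → ℝ)
    (r : ℝ) (n : ℕ) : greenSphereSum S μ r n = ∑ x ∈ sphere S n, green μ r x := by
  rw [greenSphereSum, tsum_eq_sum (s := sphere S n)]
  · exact Finset.sum_congr rfl fun x hx => if_pos ((mem_sphere hS).mp hx)
  · exact fun x hx => if_neg fun h => hx ((mem_sphere hS).mpr h)

lemma log_sphereCard_div_le {S : Finset G} (hS : Subgroup.closure (S : Set G) = ⊤) (n : ℕ) :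
    Real.log (sphereCard S n) / n ≤ Real.log (symmGen S).card := by
  have hcard : (1 : ℝ) ≤ (symmGen S).card := by
    simpa using (Nat.one_le_cast (α := ℝ)).mpr (one_le_card_symmGen_pow S 1)
  refine div_le_of_le_mul₀ (by positivity) (Real.log_nonneg hcard) ?_
  rcases (sphereCard S n).eq_zero_or_pos with h | h
  · rw [h]
    simpa using mul_nonneg (Real.log_nonneg hcard) n.cast_nonneg
  · rw [mul_comm, ← Real.log_pow]
    refine Real.log_le_log (by exact_mod_cast h) ?_
    exact_mod_cast (sphereCard_le hS n).trans Finset.card_pow_le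

/-- In a group of exponential growth all balls are exponentially large. -/
lemma exists_exp_le_card_pow {S : Finset G} (hS : Subgroup.closure (S : Set G) = ⊤)
    (hv : 0 < volumeGrowthRate S) :
    ∃ v : ℝ, 0 < v ∧ ∀ m : ℕ, Real.exp (v * m) ≤ (symmGen S ^ m).card := by
  set v := volumeGrowthRate S with hvdef
  refine ⟨v / 4, by positivity, fun m => ?_⟩
  rcases m.eq_zero_or_pos with rfl | hm
  · simp
  have hcob : IsCoboundedUnder (· ≤ ·) atTop
      fun n : ℕ => Real.log (sphereCard S n) / n :=
    IsBoundedUnder.isCoboundedUnder_le <|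
      isBoundedUnder_of ⟨0, fun n => div_nonneg (Real.log_natCast_nonneg _) n.cast_nonneg⟩
  have hfreq : ∃ᶠ n : ℕ in atTop, v / 2 < Real.log (sphereCard S n) / n :=
    frequently_lt_of_lt_limsup hcob (half_lt_self hv)
  obtain ⟨n, hlog, hn⟩ := (hfreq.and_eventually (eventually_ge_atTop m)).exists
  set q := n / m with hq
  have hq1 : 1 ≤ q := (Nat.one_le_div_iff hm).mpr hn
  have hn0 : (0 : ℝ) < n := by exact_mod_cast hm.trans_le hn
  have hqm : (q : ℝ) * m ≤ n := by exact_mod_cast Nat.div_mul_le_self n m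
  have hnq : n ≤ m * (q + 1) := (Nat.lt_mul_div_succ n hm).le
  set L := Real.log ((symmGen S ^ m).card : ℝ) with hL
  have hpos : (0 : ℝ) < (symmGen S ^ m).card := by exact_mod_cast one_le_card_symmGen_pow S m
  have hle : (sphereCard S n : ℝ) ≤ ((symmGen S ^ m).card : ℝ) ^ (q + 1) := by
    exact_mod_cast (sphereCard_le hS n).trans <|
      (Finset.card_le_card (Finset.pow_subset_pow_right (one_mem_symmGen S) hnq)).trans <| by
        rw [pow_mul]; exact Finset.card_pow_le
  have hs : (0 : ℝ) < sphereCard S n := by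
    by_contra hneg
    have : (sphereCard S n : ℝ) = 0 := le_antisymm (not_lt.mp hneg) (Nat.cast_nonneg _)
    simp only [this, Real.log_zero, zero_div] at hlog
    linarith
  have hlogle : Real.log (sphereCard S n) ≤ (q + 1) * L := by
    have := Real.log_le_log hs hle
    rwa [Real.log_pow, Nat.cast_add_one] at this
  rw [lt_div_iff₀ hn0] at hlog
  have hL0 : 0 ≤ L := Real.log_natCast_nonneg _
  have hq1' : (1 : ℝ) ≤ q := by exact_mod_cast hq1
  have hfin : v / 4 * m ≤ L := by
    have h1 : q * (v / 2 * m) ≤ q * (2 * L) := by nlinarith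
    have h2 := le_of_mul_le_mul_left h1 (by linarith)
    linarith
  calc Real.exp (v / 4 * m) ≤ Real.exp L := Real.exp_le_exp.mpr hfin
    _ = _ := Real.exp_log hpos

end Spheres

section Bridge

lemma tsum_ofReal_eq_one {α : Type*} {μ : α → ℝ} (h : (∀ x, 0 ≤ μ x) ∧ HasSum μ 1) :
    ∑' x, ENNReal.ofReal (μ x) = 1 := by
  rw [← ENNReal.ofReal_tsum_of_nonneg h.1 h.2.summable, h.2.tsum_eq, ENNReal.ofReal_one]

variable {G : Type*} [Group G]

lemma convPow_eq_toReal {μ : G → ℝ} (h : IsProbMeasure μ) (n : ℕ) (x : G) :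
    convPow μ n x = (convIter (fun y => ENNReal.ofReal (μ y)) n x).toReal := by
  induction n generalizing x with
  | zero => by_cases hx : x = 1 <;> simp [convPow, convIter, dirac, hx]
  | succ n ih =>
    rw [convPow, convIter, conv, ENNReal.tsum_toReal_eq fun y => ENNReal.mul_ne_top
      ENNReal.ofReal_ne_top (ne_top_of_tsum_eq_one (tsum_convIter (tsum_ofReal_eq_one h) n) _)]
    refine tsum_congr fun y => ?_
    rw [ENNReal.toReal_mul, ENNReal.toReal_ofReal (h.1 y), ih]

lemma green_one_eq_toReal {μ : G → ℝ} (h : IsProbMeasure μ) (x : G) :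
    green μ 1 x = (greenE (fun y => ENNReal.ofReal (μ y)) x).toReal := by
  rw [green, greenE, ENNReal.tsum_toReal_eq fun n =>
    ne_top_of_tsum_eq_one (tsum_convIter (tsum_ofReal_eq_one h) n) x]
  simp [convPow_eq_toReal h]

lemma green_one_le {μ : G → ℝ} (h : IsProbMeasure μ) (hadm : IsAdmissible μ) (x : G) :
    green μ 1 x ≤ green μ 1 1 := by
  rw [green_one_eq_toReal h, green_one_eq_toReal h]
  by_cases htop : greenE (fun y => ENNReal.ofReal (μ y)) 1 = ∞
  · obtain ⟨m, hm⟩ := hadm x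
    rw [convPow_eq_toReal h] at hm
    rw [greenE_eq_top htop (ENNReal.toReal_pos_iff.mp hm).1.ne', htop]
  · exact ENNReal.toReal_mono htop (greenE_le_greenE_one (tsum_ofReal_eq_one h) x)

lemma summable_exp_neg_mul_rpow {b : ℝ} (hb : 0 < b) :
    Summable fun k : ℕ => Real.exp (-b * (k : ℝ) ^ (1 / 3 : ℝ)) := by
  have hs : Summable fun k : ℕ => 720 / b ^ 6 * (1 / (k : ℝ) ^ 2) :=
    (Real.summable_one_div_nat_pow.mpr one_lt_two).mul_left _
  refine hs.of_norm_bounded_eventually_nat ?_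
  filter_upwards [eventually_gt_atTop 0] with k hk
  have hk0 : (0 : ℝ) < k := by exact_mod_cast hk
  set t := (k : ℝ) ^ (1 / 3 : ℝ) with ht
  have ht0 : 0 < t := by positivity
  have ht6 : t ^ 6 = (k : ℝ) ^ 2 := by
    rw [ht, ← Real.rpow_natCast, ← Real.rpow_mul hk0.le, ← Real.rpow_natCast]
    norm_num
  rw [Real.norm_of_nonneg (Real.exp_pos _).le, neg_mul, Real.exp_neg]
  have h := Real.pow_div_factorial_le_exp (b * t) (by positivity) 6
  calc (Real.exp (b * t))⁻¹ ≤ ((b * t) ^ 6 / (Nat.factorial 6 : ℕ))⁻¹ :=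
        inv_anti₀ (by positivity) h
    _ = 720 / b ^ 6 * (1 / (k : ℝ) ^ 2) := by
        rw [mul_pow, ht6]
        simp only [Nat.factorial]
        field_simp
        norm_num

/-- Under stretched exponential decay of exponent `1/3`, the Green function has cubic mass on
sets of exponential size. -/
lemma exists_sum_greenE_le {f : G → ℝ≥0∞} (hf : ∑' x, f x = 1) {b C : ℝ} (hb : 0 < b)
    (hC : 0 < C) (hdecay : ∀ (k : ℕ) (x : G),
      convIter f k x ≤ ENNReal.ofReal (C * Real.exp (-b * (k : ℝ) ^ (1 / 3 : ℝ))))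
    {D : ℝ} (hD : 1 ≤ D) :
    ∃ K : ℝ, 0 < K ∧ ∀ n : ℕ, 1 ≤ n → ∀ F : Finset G, (F.card : ℝ) ≤ D ^ n →
      ∑ x ∈ F, greenE f x ≤ ENNReal.ofReal (K * (n : ℝ) ^ 3) := by
  set a := ⌈2 * Real.log D / b⌉₊ with ha
  have hab : Real.log D ≤ b / 2 * a := by
    have := Nat.le_ceil (2 * Real.log D / b)
    rw [div_le_iff₀ hb] at this
    linarith
  have hsum := (summable_exp_neg_mul_rpow (half_pos hb)).mul_left C
  set T := ∑' k : ℕ, C * Real.exp (-(b / 2) * (k : ℝ) ^ (1 / 3 : ℝ)) with hT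
  have hT0 : 0 ≤ T := tsum_nonneg fun k => by positivity
  refine ⟨(a : ℝ) ^ 3 + T + 1, by positivity, fun n hn F hF => ?_⟩
  have hn1 : (1 : ℝ) ≤ n := by exact_mod_cast hn
  set M := (a * n) ^ 3 with hM
  have hterm : ∀ k, ∑ x ∈ F, convIter f k x ≤ (if k < M then 1 else 0) +
      ENNReal.ofReal (C * Real.exp (-(b / 2) * (k : ℝ) ^ (1 / 3 : ℝ))) := by
    intro k
    split_ifs with hk
    · refine le_add_right ?_
      exact (ENNReal.sum_le_tsum F).trans (tsum_convIter hf k).le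
    rw [zero_add]
    set t := (k : ℝ) ^ (1 / 3 : ℝ) with ht
    have hat : (a : ℝ) * n ≤ t := by
      have h3 : ((a : ℝ) * n) ^ 3 ≤ k := by exact_mod_cast not_lt.mp hk
      rw [ht, ← Real.rpow_le_rpow_iff (z := 3) (by positivity) (by positivity) (by norm_num),
        ← Real.rpow_mul (by positivity)]
      norm_num
      exact_mod_cast h3
    calc ∑ x ∈ F, convIter f k x
        ≤ ∑ x ∈ F, ENNReal.ofReal (C * Real.exp (-b * t)) :=
          Finset.sum_le_sum fun x _ => hdecay k x
      _ = ENNReal.ofReal (F.card * (C * Real.exp (-b * t))) := by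
          rw [Finset.sum_const, nsmul_eq_mul, ENNReal.ofReal_mul (p := F.card) (by positivity),
            ENNReal.ofReal_natCast]
      _ ≤ _ := by
          refine ENNReal.ofReal_le_ofReal ?_
          have hDn : D ^ n ≤ Real.exp (b / 2 * t) := by
            rw [← Real.exp_log (by linarith : 0 < D), ← Real.exp_nat_mul, Real.exp_le_exp]
            nlinarith [mul_le_mul_of_nonneg_left hab (by linarith : (0 : ℝ) ≤ n)]
          calc F.card * (C * Real.exp (-b * t))
              ≤ Real.exp (b / 2 * t) * (C * Real.exp (-b * t)) := by
                gcongr; exact hF.trans hDn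
            _ = C * Real.exp (-(b / 2) * t) := by
                rw [mul_left_comm, ← Real.exp_add]; ring_nf
  calc ∑ x ∈ F, greenE f x = ∑' k, ∑ x ∈ F, convIter f k x := by
        simp only [greenE]
        rw [Summable.tsum_finsetSum fun _ _ => ENNReal.summable]
    _ ≤ ∑' k, ((if k < M then 1 else 0) +
          ENNReal.ofReal (C * Real.exp (-(b / 2) * (k : ℝ) ^ (1 / 3 : ℝ)))) :=
        ENNReal.tsum_le_tsum hterm
    _ = ENNReal.ofReal (M + T) := by
        rw [ENNReal.tsum_add, ← ENNReal.ofReal_tsum_of_nonneg (fun k => by positivity) hsum,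
          tsum_eq_sum (s := Finset.range M) (by simp), ENNReal.ofReal_add (by positivity) hT0,
          Finset.sum_congr rfl fun k hk => if_pos (Finset.mem_range.mp hk),
          Finset.sum_const, Finset.card_range, nsmul_one, ENNReal.ofReal_natCast]
    _ ≤ _ := by
        refine ENNReal.ofReal_le_ofReal ?_
        have hn3 : (1 : ℝ) ≤ (n : ℝ) ^ 3 := one_le_pow₀ hn1
        rw [hM]
        push_cast
        nlinarith [mul_pow (a : ℝ) n 3]

lemma exists_greenSphereSum_le_cube {S : Finset G} (hS : Subgroup.closure (S : Set G) = ⊤)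
    {μ : G → ℝ} (hprob : IsProbMeasure μ) (hadm : IsAdmissible μ)
    (hv : 0 < volumeGrowthRate S) :
    ∃ C : ℝ, 0 < C ∧ ∀ n : ℕ, 1 ≤ n → greenSphereSum S μ 1 n ≤ C * (n : ℝ) ^ 3 := by
  set m : G → ℝ≥0∞ := fun y => ENNReal.ofReal (μ y) with hm
  have hm1 : ∑' x, m x = 1 := tsum_ofReal_eq_one hprob
  have hpos : ∀ x, resolvent m x ≠ 0 := by
    intro x
    obtain ⟨n, hn⟩ := hadm x
    rw [convPow_eq_toReal hprob] at hn
    exact resolvent_ne_zero (ENNReal.toReal_pos_iff.mp hn).1.ne'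
  obtain ⟨v, hv0, hgrowth⟩ := exists_exp_le_card_pow hS hv
  obtain ⟨b, C, hb, hC, hdecay⟩ := exists_convIter_le_exp (tsum_resolvent hm1)
    (one_mem_symmGen S) (fun s _ => hpos s) hv0 hgrowth
  have hD : (1 : ℝ) ≤ (symmGen S).card := by
    simpa using (Nat.one_le_cast (α := ℝ)).mpr (one_le_card_symmGen_pow S 1)
  obtain ⟨K, hK, hbound⟩ := exists_sum_greenE_le (tsum_resolvent hm1) hb hC hdecay hD
  have hfin : ∀ x, greenE (resolvent m) x ≠ ∞ := fun x =>
    ne_top_of_le_ne_top ENNReal.ofReal_ne_top (by simpa using hbound 1 le_rfl {x} (by simpa using hD))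
  have hle := greenE_le_greenE_resolvent hfin
  refine ⟨K, hK, fun n hn => ?_⟩
  rw [greenSphereSum_eq hS]
  simp only [green_one_eq_toReal hprob]
  rw [← ENNReal.toReal_sum fun x _ => ne_top_of_le_ne_top (hfin x) (hle x)]
  refine ENNReal.toReal_le_of_le_ofReal (by positivity) ?_
  refine (Finset.sum_le_sum fun x _ => hle x).trans (hbound n hn _ ?_)
  rw [← sphereCard_eq hS]
  exact_mod_cast (sphereCard_le hS n).trans Finset.card_pow_le

lemma greenSphereSum_one_nonneg {S : Finset G} (hS : Subgroup.closure (S : Set G) = ⊤)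
    {μ : G → ℝ} (hprob : IsProbMeasure μ) (n : ℕ) : 0 ≤ greenSphereSum S μ 1 n := by
  rw [greenSphereSum_eq hS]
  exact Finset.sum_nonneg fun x _ => by
    rw [green_one_eq_toReal hprob]; exact ENNReal.toReal_nonneg

lemma greenSphereSum_one_le {S : Finset G} (hS : Subgroup.closure (S : Set G) = ⊤)
    {μ : G → ℝ} (hprob : IsProbMeasure μ) (hadm : IsAdmissible μ) (n : ℕ) :
    greenSphereSum S μ 1 n ≤ green μ 1 1 * sphereCard S n := by
  rw [greenSphereSum_eq hS, sphereCard_eq hS, mul_comm, ← nsmul_eq_mul]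
  exact Finset.sum_le_card_nsmul _ _ _ fun x _ => green_one_le hprob hadm x

lemma log_le_log_add_log_natCast {h C : ℝ} {s : ℕ} (h0 : 0 ≤ h) (hC : 1 ≤ C)
    (hle : h ≤ C * s) : Real.log h ≤ Real.log C + Real.log s := by
  rcases h0.eq_or_lt with rfl | hpos
  · rw [Real.log_zero]
    exact add_nonneg (Real.log_nonneg hC) (Real.log_natCast_nonneg s)
  · have hs : (s : ℝ) ≠ 0 := by
      rintro hs
      rw [hs, mul_zero] at hle
      linarith
    rw [← Real.log_mul (by linarith) hs]
    exact Real.log_le_log hpos hle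

lemma limsup_nonpos_of_forall_eventually_le {u : ℕ → ℝ}
    (h : ∀ ε > 0, ∀ᶠ n in atTop, u n ≤ ε) : limsup u atTop ≤ 0 := by
  rw [limsup_eq]
  by_cases hb : BddBelow {a | ∀ᶠ n in atTop, u n ≤ a}
  · exact le_of_forall_pos_le_add fun ε hε => (csInf_le hb (h ε hε)).trans (zero_add ε).ge
  · exact (Real.sInf_of_not_bddBelow hb).le

/-- If `u n ≤ C * s n` with `s` of growth rate at most zero, then so is `u`. -/
lemma limsup_log_div_nonpos {u : ℕ → ℝ} {s : ℕ → ℕ} {C : ℝ} (hC : 1 ≤ C)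
    (h0 : ∀ n, 0 ≤ u n) (hle : ∀ n, 1 ≤ n → u n ≤ C * s n)
    (hs : ∀ ε > 0, ∀ᶠ n : ℕ in atTop, Real.log (s n) / n ≤ ε) :
    limsup (fun n : ℕ => Real.log (u n) / n) atTop ≤ 0 := by
  refine limsup_nonpos_of_forall_eventually_le fun ε hε => ?_
  have hC0 : ∀ᶠ n : ℕ in atTop, Real.log C / n < ε / 2 :=
    (tendsto_const_div_atTop_nhds_zero_nat _).eventually_lt_const (half_pos hε)
  filter_upwards [hC0, hs (ε / 2) (half_pos hε), eventually_ge_atTop 1] with n h1 h2 hn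
  calc Real.log (u n) / n ≤ (Real.log C + Real.log (s n)) / n := by
        gcongr
        exact log_le_log_add_log_natCast (h0 n) hC (hle n hn)
    _ ≤ ε := by rw [add_div]; linarith

lemma eventually_log_cube_div_le {ε : ℝ} (hε : 0 < ε) :
    ∀ᶠ n : ℕ in atTop, Real.log ((n ^ 3 : ℕ) : ℝ) / n ≤ ε := by
  have h := Real.isLittleO_log_id_atTop.tendsto_div_nhds_zero.comp
    (tendsto_natCast_atTop_atTop (R := ℝ))
  filter_upwards [h.eventually_lt_const (by positivity : 0 < ε / 3)] with n hn
  simp only [Function.comp_apply, id] at hn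
  rw [Nat.cast_pow, Real.log_pow, mul_div_assoc]
  push_cast
  linarith

end Bridge

/-- Let `Γ` be a finitely generated group and let `μ` be an admissible
probability measure on `Γ` whose random walk is transient at the spectral radius.
Then `ω_Γ(1) ≤ 0`.  Moreover, if `Γ` has exponential growth (`v > 0`), then there
exists a constant `C > 0` such that `H_1(n) ≤ C n³` for all `n ≥ 1`. -/
theorem greenGrowthRate_one_nonpos {G : Type*} [Group G] (S : Finset G)
    (hS : Subgroup.closure (S : Set G) = ⊤) (μ : G → ℝ)
    (hprob : IsProbMeasure μ) (hadm : IsAdmissible μ)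
    (htrans : TransientAtSpectralRadius μ) :
    greenGrowthRate S μ 1 ≤ 0 ∧
      (0 < volumeGrowthRate S →
        ∃ C : ℝ, 0 < C ∧ ∀ n : ℕ, 1 ≤ n →
          greenSphereSum S μ 1 n ≤ C * (n : ℝ) ^ 3) := by
  have hcube := exists_greenSphereSum_le_cube hS hprob hadm
  refine ⟨?_, hcube⟩
  have h0 := greenSphereSum_one_nonneg hS hprob
  by_cases hv : 0 < volumeGrowthRate S
  · obtain ⟨C, -, hle⟩ := hcube hv
    refine limsup_log_div_nonpos (s := fun n => n ^ 3) (le_max_right C 1) h0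
      (fun n hn => (hle n hn).trans ?_) fun ε hε => eventually_log_cube_div_le hε
    push_cast
    gcongr
    exact le_max_left _ _
  · refine limsup_log_div_nonpos (s := sphereCard S) (le_max_right (green μ 1 1) 1) h0
      (fun n _ => (greenSphereSum_one_le hS hprob hadm n).trans ?_) fun ε hε => ?_
    · gcongr
      exact le_max_left _ _
    · refine (eventually_lt_of_limsup_lt ((not_lt.mp hv).trans_lt hε) ?_).mono fun _ h => h.le
      exact isBoundedUnder_of ⟨_, log_sphereCard_div_le hS⟩

end GreenGrowth
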